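/- Let s = (q⃗, ε⃗) ∈ RS(S) be a reachable configuration of the composed system S = S1 ⋈_{H,K} S2 that is a deadlock configuration for S. Then either the restriction s↾1 belongs to RS(S1) and is a deadlock configuration for S1, or s↾2 belongs to RS(S2) and is a deadlock configuration for S2 (or both). -/

import Mathlib

/- Common formalization of Communicating Finite State Machines (CFSMs),
communicating systems, gateways and their composition, following
"Global Types with Internal Delegation" / GTIR paper definitions. -/

namespace GTIR

/-- Polarity of an action: `!` (send) or `?` (receive). -/
inductive Pol : Type
  | bang
  | query
deriving DecidableEq

/-- Dual polarity: swap `!` and `?`. -/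
def Pol.dual : Pol → Pol
  | .bang => .query
  | .query => .bang

/-- Actions over roles `R` and messages `A`:
`snd s r a` is `sr!a` (s sends `a` to r), `rcv s r a` is `sr?a`
(r receives/consumes `a` sent by s). -/
inductive Act (R A : Type) : Type
  | snd : R → R → A → Act R A
  | rcv : R → R → A → Act R A

/-- The action is a send action. -/
def Act.isSend {R A : Type} : Act R A → Prop
  | .snd _ _ _ => True
  | .rcv _ _ _ => False

/-- The action is a receive action. -/
def Act.isRecv {R A : Type} : Act R A → Prop
  | .snd _ _ _ => False
  | .rcv _ _ _ => True

/-- Erase the channel name of an action: `pq!a ↦ !a`, `pq?a ↦ ?a`. -/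
def Act.noC {R A : Type} : Act R A → Pol × A
  | .snd _ _ a => (.bang, a)
  | .rcv _ _ a => (.query, a)

/-- The dual of a word over `{!,?} × A`: swap `!` and `?` pointwise. -/
def dualWord {A : Type} (w : List (Pol × A)) : List (Pol × A) :=
  w.map fun x => (x.1.dual, x.2)

/-- Universal state type: base states from `B`, plus arbitrarily nested fresh
"hat" states (one for each transition) used by the gateway construction. -/
inductive St (R A B : Type) : Type
  | base : B → St R A B
  | hat : St R A B → Act R A → St R A B → St R A B

/-- A communicating finite state machine over roles `R` and messages `A`,
with states taken from `St R A B`: an initial state together with a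
transition relation. -/
structure CFSM (R A B : Type) where
  init : St R A B
  delta : Set (St R A B × Act R A × St R A B)

namespace CFSM

variable {R A B : Type}

/-- A state is final if it has no outgoing transition. -/
def Final (M : CFSM R A B) (q : St R A B) : Prop :=
  ∀ l q', (q, l, q') ∉ M.delta

/-- A sending state: non-final, and all outgoing transitions are sends. -/
def Sending (M : CFSM R A B) (q : St R A B) : Prop :=
  (∃ l q', (q, l, q') ∈ M.delta) ∧ ∀ l q', (q, l, q') ∈ M.delta → l.isSend

/-- A receiving state: non-final, and all outgoing transitions are receives. -/
def Receiving (M : CFSM R A B) (q : St R A B) : Prop :=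
  (∃ l q', (q, l, q') ∈ M.delta) ∧ ∀ l q', (q, l, q') ∈ M.delta → l.isRecv

/-- A mixed state: it has both an outgoing send and an outgoing receive. -/
def Mixed (M : CFSM R A B) (q : St R A B) : Prop :=
  (∃ l q', (q, l, q') ∈ M.delta ∧ l.isSend) ∧
  (∃ l q', (q, l, q') ∈ M.delta ∧ l.isRecv)

/-- `M` has no mixed states. -/
def NoMixed (M : CFSM R A B) : Prop := ∀ q, ¬ M.Mixed q

/-- `?`-determinism: two receives of the same message from the same state
(possibly on different channels) have the same target. -/
def QDet (M : CFSM R A B) : Prop :=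
  ∀ q a s r s' r' q' q'', (q, Act.rcv s r a, q') ∈ M.delta →
    (q, Act.rcv s' r' a, q'') ∈ M.delta → q' = q''

/-- `!`-determinism: two sends of the same message from the same state
(possibly on different channels) have the same target. -/
def BDet (M : CFSM R A B) : Prop :=
  ∀ q a s r s' r' q' q'', (q, Act.snd s r a, q') ∈ M.delta →
    (q, Act.snd s' r' a, q'') ∈ M.delta → q' = q''

/-- `?!`-determinism. -/
def IODet (M : CFSM R A B) : Prop := M.QDet ∧ M.BDet

/-- Accepting runs from a given state (every state is accepting). -/
inductive Accepts (M : CFSM R A B) : St R A B → List (Act R A) → Prop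
  | nil (q : St R A B) : Accepts M q []
  | cons {q : St R A B} {l : Act R A} {q' : St R A B} {φ : List (Act R A)} :
      (q, l, q') ∈ M.delta → Accepts M q' φ → Accepts M q (l :: φ)

/-- The language of `M` over `Act`. -/
def lang (M : CFSM R A B) : Set (List (Act R A)) := {φ | M.Accepts M.init φ}

/-- The language of `M` with channel names erased. -/
def langNoC (M : CFSM R A B) : Set (List (Pol × A)) :=
  (fun φ => φ.map Act.noC) '' M.lang

/-- Compatibility `M ↔ M'`: the channel-erased language of `M` is the set of
duals of the channel-erased language of `M'`; moreover neither machine has a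
mixed state and both are `?!`-deterministic. -/
def Compat (M M' : CFSM R A B) : Prop :=
  M.langNoC = dualWord '' M'.langNoC ∧
  M.NoMixed ∧ M'.NoMixed ∧ M.IODet ∧ M'.IODet

/-- The machine of role `p` over the role set `P`: every transition label is
an action of `p` (a send `pr!a` or a receive `rp?a`) with partner `r ∈ P`. -/
def ActsFor (M : CFSM R A B) (p : R) (P : Set R) : Prop :=
  ∀ q l q', (q, l, q') ∈ M.delta →
    ∃ r a, r ∈ P ∧ r ≠ p ∧ (l = Act.snd p r a ∨ l = Act.rcv r p a)

/-- All states occurring in `M` are base states; this guarantees that the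
intermediate "hat" states of the gateway construction are fresh for `M`. -/
def HatFree (M : CFSM R A B) : Prop :=
  (∃ b, M.init = St.base b) ∧
  ∀ q l q', (q, l, q') ∈ M.delta →
    (∃ b, q = St.base b) ∧ (∃ b, q' = St.base b)

/-- The set `Q̂` of fresh intermediate gateway states of `M`
(one for each transition of `M`). -/
def hatStates (M : CFSM R A B) : Set (St R A B) :=
  {x | ∃ q l q', (q, l, q') ∈ M.delta ∧ x = St.hat q l q'}

/-- The gateway `gw(M_H, K)` of the machine `M` of role `H` towards role `K`:
each transition `t = (q, Hs!a, q')` of `M` is replaced by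
`(q, KH?a, q̂_t)` and `(q̂_t, Hs!a, q')`, and each transition
`t = (q, sH?a, q')` of `M` is replaced by `(q, sH?a, q̂_t)` and
`(q̂_t, HK!a, q')`. -/
def gw (M : CFSM R A B) (H K : R) : CFSM R A B where
  init := M.init
  delta :=
    {x | ∃ q s a q', (q, Act.snd H s a, q') ∈ M.delta ∧
      (x = (q, Act.rcv K H a, St.hat q (Act.snd H s a) q') ∨
       x = (St.hat q (Act.snd H s a) q', Act.snd H s a, q'))} ∪
    {x | ∃ q s a q', (q, Act.rcv s H a, q') ∈ M.delta ∧
      (x = (q, Act.rcv s H a, St.hat q (Act.rcv s H a) q') ∨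
       x = (St.hat q (Act.rcv s H a) q', Act.snd H K a, q'))}

end CFSM

/-- A communicating system: a set of roles together with a CFSM for each role. -/
structure CS (R A B : Type) where
  roles : Set R
  mach : R → CFSM R A B

namespace CS

variable {R A B : Type}

/-- Well-formedness: the machine of each role `p` of the system only carries
actions of `p` with partners among the system's roles. -/
def WF (S : CS R A B) : Prop :=
  ∀ p ∈ S.roles, (S.mach p).ActsFor p S.roles

/-- Each machine of the system has a finite transition relation
(hence finitely many relevant states). -/
def FiniteSys (S : CS R A B) : Prop :=
  ∀ p ∈ S.roles, (S.mach p).delta.Finite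

open scoped Classical in
/-- Composition `S1 ⋈_{H,K} S2`: the union of the two systems, where the
machines of the interface roles `H` and `K` are replaced by the gateways
`gw(M¹_H, K)` and `gw(M²_K, H)`. -/
noncomputable def compose (S1 S2 : CS R A B) (H K : R) : CS R A B where
  roles := S1.roles ∪ S2.roles
  mach := fun p =>
    if p = H then (S1.mach H).gw H K
    else if p = K then (S2.mach K).gw K H
    else if p ∈ S1.roles then S1.mach p
    else S2.mach p

end CS

/-- A configuration: a local state for every role and a buffer (word over the
messages) for every ordered channel. -/
structure Config (R A B : Type) where
  st : R → St R A B
  buf : R → R → List A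

/-- The initial configuration(s) of a system: every machine of the system is
in its initial state and all the system's buffers are empty. -/
def InitConf {R A B : Type} (S : CS R A B) (c : Config R A B) : Prop :=
  (∀ p ∈ S.roles, c.st p = (S.mach p).init) ∧
  (∀ p ∈ S.roles, ∀ q ∈ S.roles, c.buf p q = [])

/-- One asynchronous step of system `S`, labelled by an action:
a send `sr!a` appends `a` to the buffer of channel `sr`, a receive `sr?a`
removes `a` from the front of the buffer of channel `sr`; everything else is
unchanged. -/
def Step {R A B : Type} (S : CS R A B) (c : Config R A B) :
    Act R A → Config R A B → Prop
  | .snd s r a, c' =>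
      s ∈ S.roles ∧ (c.st s, Act.snd s r a, c'.st s) ∈ (S.mach s).delta ∧
      (∀ p, p ≠ s → c'.st p = c.st p) ∧
      c'.buf s r = c.buf s r ++ [a] ∧
      (∀ p q, ¬(p = s ∧ q = r) → c'.buf p q = c.buf p q)
  | .rcv s r a, c' =>
      r ∈ S.roles ∧ (c.st r, Act.rcv s r a, c'.st r) ∈ (S.mach r).delta ∧
      (∀ p, p ≠ r → c'.st p = c.st p) ∧
      c.buf s r = a :: c'.buf s r ∧
      (∀ p q, ¬(p = s ∧ q = r) → c'.buf p q = c.buf p q)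

/-- `RS(S)`: the configurations reachable from the initial configuration. -/
def Reach {R A B : Type} (S : CS R A B) (c : Config R A B) : Prop :=
  ∃ c₀, InitConf S c₀ ∧
    Relation.ReflTransGen (fun x y => ∃ l, Step S x l y) c₀ c

/-- Deadlock configuration: all the system's buffers are empty and every
machine is in a receiving state. -/
def DeadlockConf {R A B : Type} (S : CS R A B) (c : Config R A B) : Prop :=
  (∀ p ∈ S.roles, ∀ q ∈ S.roles, c.buf p q = []) ∧
  ∀ p ∈ S.roles, (S.mach p).Receiving (c.st p)

/-- A system is deadlock-free if no reachable configuration is a deadlock. -/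
def DeadlockFree {R A B : Type} (S : CS R A B) : Prop :=
  ∀ c, Reach S c → ¬ DeadlockConf S c

/-- Orphan-message configuration: every machine is in a final state but some
buffer of the system is non-empty. -/
def OrphanConf {R A B : Type} (S : CS R A B) (c : Config R A B) : Prop :=
  (∀ p ∈ S.roles, (S.mach p).Final (c.st p)) ∧
  ∃ p ∈ S.roles, ∃ q ∈ S.roles, c.buf p q ≠ []

/-- Unspecified reception configuration: some machine is in a receiving state
but each of its expected input buffers is non-empty and starts with a message
it cannot receive. -/
def UnspecConf {R A B : Type} (S : CS R A B) (c : Config R A B) : Prop :=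
  ∃ r ∈ S.roles, (S.mach r).Receiving (c.st r) ∧
    ∀ s a q', (c.st r, Act.rcv s r a, q') ∈ (S.mach r).delta →
      c.buf s r ≠ [] ∧ ∀ w, c.buf s r ≠ a :: w

/-- A system is safe if no reachable configuration is a deadlock,
an orphan-message, or an unspecified reception configuration. -/
def Safe {R A B : Type} (S : CS R A B) : Prop :=
  ∀ c, Reach S c →
    ¬ DeadlockConf S c ∧ ¬ OrphanConf S c ∧ ¬ UnspecConf S c

end GTIR

namespace GTIR

variable {R A B : Type}

def Path (M : CFSM R A B) : St R A B → List (Pol × A) → St R A B → Prop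
  | q, [], q' => q = q'
  | q, x :: w, q' => ∃ l q1, (q, l, q1) ∈ M.delta ∧ l.noC = x ∧ Path M q1 w q'

theorem path_append (M : CFSM R A B) (w w' : List (Pol × A)) : ∀ q q',
    Path M q (w ++ w') q' ↔ ∃ q1, Path M q w q1 ∧ Path M q1 w' q' := by
  induction w with
  | nil => intro q q'; simp [Path]
  | cons x w ih =>
    intro q q'
    simp only [List.cons_append, Path, ih]
    constructor
    · rintro ⟨l, q1, h1, h2, q2, h3, h4⟩
      exact ⟨q2, ⟨l, q1, h1, h2, h3⟩, h4⟩
    · rintro ⟨q2, ⟨l, q1, h1, h2, h3⟩, h4⟩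
      exact ⟨l, q1, h1, h2, q2, h3, h4⟩

theorem path_snoc {M : CFSM R A B} {w : List (Pol × A)} {q q1 q' : St R A B} {l : Act R A}
    {x : Pol × A} (h : Path M q w q1) (ht : (q1, l, q') ∈ M.delta) (hx : l.noC = x) :
    Path M q (w ++ [x]) q' :=
  (path_append M w [x] q q').2 ⟨q1, h, l, q', ht, hx, rfl⟩

theorem delta_det {M : CFSM R A B} (hd : M.IODet) {q q1 q2 : St R A B} {l l' : Act R A}
    (h1 : (q, l, q1) ∈ M.delta) (h2 : (q, l', q2) ∈ M.delta) (h : l.noC = l'.noC) :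
    q1 = q2 := by
  obtain ⟨hq, hb⟩ := hd
  cases l with
  | snd s r a =>
    cases l' with
    | snd s' r' a' =>
      simp only [Act.noC, Prod.mk.injEq, true_and] at h
      subst h; exact hb _ _ _ _ _ _ _ _ h1 h2
    | rcv s' r' a' => simp [Act.noC] at h
  | rcv s r a =>
    cases l' with
    | rcv s' r' a' =>
      simp only [Act.noC, Prod.mk.injEq, true_and] at h
      subst h; exact hq _ _ _ _ _ _ _ _ h1 h2
    | snd s' r' a' => simp [Act.noC] at h

theorem path_det {M : CFSM R A B} (hd : M.IODet) (w : List (Pol × A)) : ∀ q q1 q2,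
    Path M q w q1 → Path M q w q2 → q1 = q2 := by
  induction w with
  | nil => intro q q1 q2 h1 h2; exact h1.symm.trans h2
  | cons x w ih =>
    rintro q q1 q2 ⟨l, r, h1, h2, h3⟩ ⟨l', r', h1', h2', h3'⟩
    have := delta_det hd h1 h1' (h2.trans h2'.symm)
    subst this
    exact ih _ _ _ h3 h3'

theorem accepts_path {M : CFSM R A B} {q : St R A B} {φ : List (Act R A)}
    (h : M.Accepts q φ) : ∃ q', Path M q (φ.map Act.noC) q' := by
  induction h with
  | nil q => exact ⟨q, rfl⟩
  | cons h1 _ ih =>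
    obtain ⟨q', h⟩ := ih
    exact ⟨q', _, _, h1, rfl, h⟩

theorem path_accepts {M : CFSM R A B} (w : List (Pol × A)) : ∀ q q', Path M q w q' →
    ∃ φ, M.Accepts q φ ∧ φ.map Act.noC = w := by
  induction w with
  | nil => intro q q' _; exact ⟨[], .nil q, rfl⟩
  | cons x w ih =>
    rintro q q' ⟨l, q1, h1, h2, h3⟩
    obtain ⟨φ, h4, h5⟩ := ih _ _ h3
    exact ⟨l :: φ, .cons h1 h4, by simp [h2, h5]⟩

theorem mem_lang (M : CFSM R A B) (w : List (Pol × A)) :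
    w ∈ M.langNoC ↔ ∃ q, Path M M.init w q := by
  constructor
  · rintro ⟨φ, h, rfl⟩; exact accepts_path h
  · rintro ⟨q, h⟩
    obtain ⟨φ, h1, h2⟩ := path_accepts _ _ _ h
    exact ⟨φ, h1, h2⟩

theorem dual_dual (w : List (Pol × A)) : dualWord (dualWord w) = w := by
  simp only [dualWord, List.map_map]
  conv_rhs => rw [← List.map_id w]
  congr 1
  funext ⟨p, a⟩
  cases p <;> rfl

theorem dual_append (w w' : List (Pol × A)) : dualWord (w ++ w') = dualWord w ++ dualWord w' := by
  simp [dualWord]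

theorem compat_symm {M M' : CFSM R A B} (h : M.Compat M') : M'.Compat M := by
  obtain ⟨h1, h2, h3, h4, h5⟩ := h
  refine ⟨?_, h3, h2, h5, h4⟩
  rw [h1, Set.image_image]
  simp [dual_dual]

theorem compat_path {M M' : CFSM R A B} (h : M.Compat M') {w : List (Pol × A)} {q : St R A B}
    (hp : Path M M.init w q) : ∃ q', Path M' M'.init (dualWord w) q' := by
  have : w ∈ M.langNoC := (mem_lang _ _).2 ⟨q, hp⟩
  rw [h.1] at this
  obtain ⟨v, hv, rfl⟩ := this
  rw [dual_dual]
  exact (mem_lang _ _).1 hv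

theorem path_next {M : CFSM R A B} (hd : M.IODet) {w w' : List (Pol × A)} {x : Pol × A}
    {q q0 q' : St R A B} (h : Path M q0 w q) (h' : Path M q0 (w ++ x :: w') q') :
    ∃ l q1, (q, l, q1) ∈ M.delta ∧ l.noC = x := by
  obtain ⟨q1, h1, l, q2, h2, h3, _⟩ := (path_append _ _ _ _ _).1 h'
  have := path_det hd _ _ _ _ h h1
  subst this
  exact ⟨l, q2, h2, h3⟩

def Inv (M M' : CFSM R A B) (q q' : St R A B) (b b' : List A) : Prop :=
  ∃ u v, Path M M.init u q ∧ Path M' M'.init v q' ∧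
    ((b' = [] ∧ u = dualWord v ++ b.map (fun a => (Pol.query, a))) ∨
     (b = [] ∧ v = dualWord u ++ b'.map (fun a => (Pol.query, a))))

theorem inv_symm {M M' : CFSM R A B} {q q' : St R A B} {b b' : List A}
    (h : Inv M M' q q' b b') : Inv M' M q' q b' b := by
  obtain ⟨u, v, h1, h2, h3⟩ := h
  exact ⟨v, u, h2, h1, h3.symm⟩

theorem inv_send {M M' : CFSM R A B} (hc : M.Compat M') {q q' q1 : St R A B} {b b' : List A}
    {s r : R} {a : A}
    (h : Inv M M' q q' b b') (ht : (q, Act.rcv s r a, q1) ∈ M.delta) :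
    Inv M M' q1 q' (b ++ [a]) b' := by
  obtain ⟨u, v, h1, h2, h3⟩ := h
  have key : b' = [] ∧ u = dualWord v ++ b.map (fun a => (Pol.query, a)) := by
    rcases h3 with h3 | ⟨h3, h4⟩
    · exact h3
    · cases b' with
      | nil =>
        refine ⟨rfl, ?_⟩
        subst h3; simp at h4; subst h4; simp [dual_dual]
      | cons c b' =>
        exfalso
        obtain ⟨p, hp⟩ := compat_path (compat_symm hc) h2
        rw [h4, dual_append, dual_dual] at hp
        simp only [List.map_cons] at hp
        obtain ⟨l, q2, h5, h6⟩ := path_next hc.2.2.2.1 h1 hp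
        refine hc.2.1 q ⟨⟨l, q2, h5, ?_⟩, _, _, ht, trivial⟩
        cases l with
        | snd => trivial
        | rcv => simp [Act.noC, Pol.dual] at h6
  obtain ⟨k1, k2⟩ := key
  refine ⟨u ++ [(Pol.query, a)], v, path_snoc h1 ht rfl, h2, Or.inl ⟨k1, ?_⟩⟩
  simp [k2]

theorem inv_recv {M M' : CFSM R A B} {q q' q1 : St R A B} {b b' : List A}
    {s r : R} {a : A}
    (h : Inv M M' q q' b (a :: b')) (ht : (q, Act.snd s r a, q1) ∈ M.delta) :
    Inv M M' q1 q' b b' := by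
  obtain ⟨u, v, h1, h2, h3⟩ := h
  rcases h3 with ⟨h3, _⟩ | ⟨h3, h4⟩
  · simp at h3
  · refine ⟨u ++ [(Pol.bang, a)], v, path_snoc h1 ht rfl, h2, Or.inr ⟨h3, ?_⟩⟩
    rw [h4]
    simp [dualWord, Pol.dual]

/-- view of the gateway from the partner gateway -/
def view : St R A B → St R A B
  | .base b => .base b
  | .hat _ (.snd _ _ _) q' => q'
  | .hat q (.rcv _ _ _) _ => q

/-- view of the gateway from its own system -/
def own : St R A B → St R A B
  | .base b => .base b
  | .hat q (.snd _ _ _) _ => q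
  | .hat _ (.rcv _ _ _) q' => q'

theorem gw_view {M : CFSM R A B} {H K : R} {P : Set R} (hf : M.HatFree) (ha : M.ActsFor H P)
    (hK : K ∉ P) {x x' : St R A B} {l : Act R A} (h : (x, l, x') ∈ (M.gw H K).delta) :
    (∃ a s, l = Act.rcv K H a ∧ (view x, Act.snd H s a, view x') ∈ M.delta) ∨
    (∃ a s, l = Act.snd H K a ∧ (view x, Act.rcv s H a, view x') ∈ M.delta) ∨
    (view x = view x' ∧ ∃ s a, s ≠ K ∧ (l = Act.snd H s a ∨ l = Act.rcv s H a)) := by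
  rcases h with ⟨q, s, a, q', hd, h⟩ | ⟨q, s, a, q', hd, h⟩
  all_goals
    obtain ⟨⟨b, rfl⟩, ⟨b', rfl⟩⟩ := hf.2 _ _ _ hd
    have hs : s ≠ K := by
      rintro rfl
      obtain ⟨r, a', hr, _, h | h⟩ := ha _ _ _ hd <;> simp_all
    rcases h with h | h <;> (simp only [Prod.mk.injEq] at h; obtain ⟨rfl, rfl, rfl⟩ := h)
  · exact Or.inl ⟨a, s, rfl, hd⟩
  · exact Or.inr (Or.inr ⟨rfl, s, a, hs, Or.inl rfl⟩)
  · exact Or.inr (Or.inr ⟨rfl, s, a, hs, Or.inr rfl⟩)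
  · exact Or.inr (Or.inl ⟨a, s, rfl, hd⟩)

theorem gw_own {M : CFSM R A B} {H K : R} {P : Set R} (hf : M.HatFree) (ha : M.ActsFor H P)
    {x x' : St R A B} {l : Act R A} (h : (x, l, x') ∈ (M.gw H K).delta) :
    (own x = own x' ∧ ∃ a, (l = Act.snd H K a ∨ l = Act.rcv K H a)) ∨
    ((own x, l, own x') ∈ M.delta ∧ ∃ s a, s ∈ P ∧ (l = Act.snd H s a ∨ l = Act.rcv s H a)) := by
  rcases h with ⟨q, s, a, q', hd, h⟩ | ⟨q, s, a, q', hd, h⟩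
  all_goals
    obtain ⟨⟨b, rfl⟩, ⟨b', rfl⟩⟩ := hf.2 _ _ _ hd
    have hs : s ∈ P := by
      obtain ⟨r, a', hr, _, h | h⟩ := ha _ _ _ hd <;> simp_all
    rcases h with h | h <;> (simp only [Prod.mk.injEq] at h; obtain ⟨rfl, rfl, rfl⟩ := h)
  · exact Or.inl ⟨rfl, a, Or.inr rfl⟩
  · exact Or.inr ⟨hd, s, a, hs, Or.inl rfl⟩
  · exact Or.inr ⟨hd, s, a, hs, Or.inr rfl⟩
  · exact Or.inl ⟨rfl, a, Or.inl rfl⟩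

/-- `S1` is one side of the composed system `S`. -/
structure Side (S1 S : CS R A B) (H K : R) : Prop where
  hH : H ∈ S1.roles
  hK : K ∉ S1.roles
  wf : S1.WF
  hf : (S1.mach H).HatFree
  sub : S1.roles ⊆ S.roles
  mH : S.mach H = (S1.mach H).gw H K
  mp : ∀ p ∈ S1.roles, p ≠ H → S.mach p = S1.mach p

def mover : Act R A → R
  | .snd s _ _ => s
  | .rcv _ r _ => r

theorem step_delta {S : CS R A B} {c c' : Config R A B} {l : Act R A} (h : Step S c l c') :
    (c.st (mover l), l, c'.st (mover l)) ∈ (S.mach (mover l)).delta := by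
  cases l <;> exact h.2.1

theorem step_st {S : CS R A B} {c c' : Config R A B} {l : Act R A} (h : Step S c l c')
    {p : R} (hp : p ≠ mover l) : c'.st p = c.st p := by
  cases l <;> exact h.2.2.1 p hp

theorem step_buf {S : CS R A B} {c c' : Config R A B} {l : Act R A} (h : Step S c l c')
    {p q : R} (hp : p ≠ mover l) (hq : q ≠ mover l) : c'.buf p q = c.buf p q := by
  cases l with
  | snd s r a => exact h.2.2.2.2 p q (fun e => hp e.1)
  | rcv s r a => exact h.2.2.2.2 p q (fun e => hq e.2)

def SInv (S1 S2 : CS R A B) (H K : R) (c : Config R A B) : Prop :=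
  Inv (S1.mach H) (S2.mach K) (view (c.st H)) (view (c.st K)) (c.buf H K) (c.buf K H)

theorem sinv_step_half {S1 S2 S : CS R A B} {H K : R} (hs : Side S1 S H K)
    (hc : (S1.mach H).Compat (S2.mach K)) {c c' : Config R A B} {l : Act R A}
    (h : Step S c l c') (hm : mover l = H) (hi : SInv S1 S2 H K c) : SInv S1 S2 H K c' := by
  have hKH : K ≠ H := fun e => hs.hK (e ▸ hs.hH)
  have hd := step_delta h
  have hst : c'.st K = c.st K := step_st h (by rw [hm]; exact hKH)
  rw [hm, hs.mH] at hd
  unfold SInv at *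
  rw [hst]
  rcases gw_view hs.hf (hs.wf H hs.hH) hs.hK hd with ⟨a, s, rfl, ht⟩ | ⟨a, s, rfl, ht⟩ |
    ⟨hv, s, a, hsK, rfl | rfl⟩
  · obtain ⟨_, _, _, h4, h5⟩ := h
    rw [h5 H K (fun e => hKH e.1.symm)]
    rw [h4] at hi
    exact inv_recv hi ht
  · obtain ⟨_, _, _, h4, h5⟩ := h
    rw [h5 K H (fun e => hKH e.1), h4]
    exact inv_send hc hi ht
  · obtain ⟨_, _, _, h4, h5⟩ := h
    rw [h5 K H (fun e => hKH e.1), h5 H K (fun e => hsK e.2.symm), ← hv]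
    exact hi
  · obtain ⟨_, _, _, h4, h5⟩ := h
    rw [h5 K H (fun e => hsK e.1.symm), h5 H K (fun e => hKH e.2), ← hv]
    exact hi

theorem sinv_step {S1 S2 S : CS R A B} {H K : R} (hs : Side S1 S H K) (hs' : Side S2 S K H)
    (hc : (S1.mach H).Compat (S2.mach K)) {c c' : Config R A B} {l : Act R A}
    (h : Step S c l c') (hi : SInv S1 S2 H K c) : SInv S1 S2 H K c' := by
  by_cases h1 : mover l = H
  · exact sinv_step_half hs hc h h1 hi
  by_cases h2 : mover l = K
  · exact inv_symm (sinv_step_half hs' (compat_symm hc) h h2 (inv_symm hi))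
  have e1 := step_st h (Ne.symm h1)
  have e2 := step_st h (Ne.symm h2)
  have e3 := step_buf h (Ne.symm h1) (Ne.symm h2)
  have e4 := step_buf h (Ne.symm h2) (Ne.symm h1)
  unfold SInv at *
  rw [e1, e2, e3, e4]
  exact hi

open scoped Classical in
noncomputable def proj (S1 : CS R A B) (H : R) (d c : Config R A B) : Config R A B where
  st p := if p = H then own (c.st p) else if p ∈ S1.roles then c.st p else d.st p
  buf p q := if p ∈ S1.roles ∧ q ∈ S1.roles then c.buf p q else d.buf p q

theorem proj_step {S1 S : CS R A B} {H K : R} (hs : Side S1 S H K) (d : Config R A B)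
    {c c' : Config R A B} {l : Act R A} (h : Step S c l c') :
    proj S1 H d c = proj S1 H d c' ∨ Step S1 (proj S1 H d c) l (proj S1 H d c') := by
  have hd := step_delta h
  -- a moving machine of `S1` whose partner is in `S1`
  have good : mover l ∈ S1.roles →
      ((proj S1 H d c).st (mover l), l, (proj S1 H d c').st (mover l)) ∈
        (S1.mach (mover l)).delta →
      Step S1 (proj S1 H d c) l (proj S1 H d c') := by
    intro hm ht
    obtain ⟨r', a', hr', _, hl⟩ := hs.wf _ hm _ _ _ ht
    have hst : ∀ p, p ≠ mover l → (proj S1 H d c').st p = (proj S1 H d c).st p := by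
      intro p hp
      simp only [proj, step_st h hp]
    cases l with
    | snd s r a =>
      simp only [mover, reduceCtorEq, or_false, Act.snd.injEq, true_and] at hl
      obtain ⟨rfl, rfl⟩ := hl
      refine ⟨hm, ht, hst, ?_, ?_⟩
      · have h1 : s ∈ S1.roles := hm
        simp only [proj, h1, hr', and_self, if_true]
        exact h.2.2.2.1
      · intro p q hpq
        simp only [proj, h.2.2.2.2 p q hpq]
    | rcv s r a =>
      simp only [mover, reduceCtorEq, false_or, Act.rcv.injEq, true_and] at hl
      obtain ⟨rfl, rfl⟩ := hl
      refine ⟨hm, ht, hst, ?_, ?_⟩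
      · have h1 : r ∈ S1.roles := hm
        simp only [proj, h1, hr', and_self, if_true]
        exact h.2.2.2.1
      · intro p q hpq
        simp only [proj, h.2.2.2.2 p q hpq]
  by_cases hm : mover l ∈ S1.roles
  · by_cases hH : mover l = H
    · rw [hH, hs.mH] at hd
      rcases gw_own hs.hf (hs.wf H hs.hH) hd with ⟨ho, a, hl⟩ | ⟨ht, _⟩
      · left
        have hb : ∀ p ∈ S1.roles, ∀ q ∈ S1.roles, c'.buf p q = c.buf p q := by
          intro p hp q hq
          rcases hl with rfl | rfl
          · exact h.2.2.2.2 p q (fun e => hs.hK (e.2 ▸ hq))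
          · exact h.2.2.2.2 p q (fun e => hs.hK (e.1 ▸ hp))
        simp only [proj, Config.mk.injEq]
        constructor
        · funext p
          by_cases hp : p = H
          · subst hp; simp [ho]
          · simp [hp, step_st h (show p ≠ mover l by rw [hH]; exact hp)]
        · funext p q
          by_cases hpq : p ∈ S1.roles ∧ q ∈ S1.roles
          · simp [hpq, hb p hpq.1 q hpq.2]
          · simp [hpq]
      · right
        apply good hm
        rw [hH]
        simpa [proj] using ht
    · right
      apply good hm
      rw [hs.mp _ hm hH] at hd
      simpa [proj, hm, hH] using hd
  · left
    have ne : ∀ p ∈ S1.roles, p ≠ mover l := fun p hp e => hm (e ▸ hp)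
    simp only [proj, Config.mk.injEq]
    constructor
    · funext p
      by_cases hp : p = H
      · subst hp; simp [step_st h (ne _ hs.hH)]
      · by_cases hp' : p ∈ S1.roles
        · simp [hp, step_st h (ne _ hp')]
        · simp [hp, hp']
    · funext p q
      by_cases hpq : p ∈ S1.roles ∧ q ∈ S1.roles
      · simp [hpq, step_buf h (ne _ hpq.1) (ne _ hpq.2)]
      · simp [hpq]

theorem gw_init {S1 S : CS R A B} {H K : R} (hs : Side S1 S H K) :
    ∃ b, (S.mach H).init = St.base b ∧ (S1.mach H).init = St.base b := by
  obtain ⟨b, hb⟩ := hs.hf.1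
  exact ⟨b, by rw [hs.mH]; exact hb, hb⟩

theorem proj_reach {S1 S : CS R A B} {H K : R} (hs : Side S1 S H K)
    {c : Config R A B} (hc : Reach S c) (hb : ∃ b, c.st H = St.base b) : Reach S1 c := by
  obtain ⟨c0, ⟨hi1, hi2⟩, hr⟩ := hc
  have hcc : proj S1 H c c = c := by
    obtain ⟨b, hb⟩ := hb
    cases c
    simp only [proj, Config.mk.injEq]
    constructor
    · funext p
      by_cases hp : p = H
      · subst hp; simp only [if_true]; simp only at hb; rw [hb]; rfl
      · simp [hp]
    · funext p q; simp
  refine ⟨proj S1 H c c0, ⟨?_, ?_⟩, ?_⟩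
  · intro p hp
    have := hi1 p (hs.sub hp)
    by_cases hpH : p = H
    · subst hpH
      obtain ⟨b, h1, h2⟩ := gw_init hs
      simp [proj, this, h1, h2, own]
    · simp [proj, hpH, hp, this, hs.mp p hp hpH]
  · intro p hp q hq
    simp [proj, hp, hq, hi2 p (hs.sub hp) q (hs.sub hq)]
  · have : ∀ x, Relation.ReflTransGen (fun x y => ∃ l, Step S x l y) c0 x →
        Relation.ReflTransGen (fun x y => ∃ l, Step S1 x l y) (proj S1 H c c0) (proj S1 H c x) := by
      intro x hx
      induction hx with
      | refl => exact .refl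
      | tail _ h ih =>
        obtain ⟨l, h⟩ := h
        rcases proj_step hs c h with e | e
        · rw [← e]; exact ih
        · exact ih.tail ⟨l, e⟩
    have h := this c hr
    rwa [hcc] at h

theorem sinv_reach {S1 S2 S : CS R A B} {H K : R} (hs : Side S1 S H K) (hs' : Side S2 S K H)
    (hc : (S1.mach H).Compat (S2.mach K)) {c : Config R A B} (h : Reach S c) :
    SInv S1 S2 H K c := by
  obtain ⟨c0, ⟨hi1, hi2⟩, hr⟩ := h
  induction hr with
  | refl =>
    have hH := hs.sub hs.hH
    have hK := hs'.sub hs'.hH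
    obtain ⟨b, h1, h2⟩ := gw_init hs
    obtain ⟨b', h1', h2'⟩ := gw_init hs'
    refine ⟨[], [], ?_, ?_, Or.inl ⟨hi2 _ hK _ hH, ?_⟩⟩
    · simp [Path, hi1 _ hH, h1, h2, view]
    · simp [Path, hi1 _ hK, h1', h2', view]
    · simp [hi2 _ hH _ hK, dualWord]
  | tail _ h ih =>
    obtain ⟨l, h⟩ := h
    exact sinv_step hs hs' hc h ih

/-- a receiving state of the gateway is a non-final base state -/
theorem gw_receiving {S1 S : CS R A B} {H K : R} (hs : Side S1 S H K) {x : St R A B}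
    (h : (S.mach H).Receiving x) :
    (∃ b, x = St.base b) ∧ ∃ l q', (x, l, q') ∈ (S1.mach H).delta := by
  rw [hs.mH] at h
  obtain ⟨⟨l, q', h1⟩, h2⟩ := h
  have h3 := h2 _ _ h1
  rcases h1 with ⟨q, s, a, q', hd, h | h⟩ | ⟨q, s, a, q', hd, h | h⟩ <;>
    (simp only [Prod.mk.injEq] at h; obtain ⟨rfl, rfl, rfl⟩ := h)
  · exact ⟨(hs.hf.2 _ _ _ hd).1, _, _, hd⟩
  · exact h3.elim
  · exact ⟨(hs.hf.2 _ _ _ hd).1, _, _, hd⟩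
  · exact h3.elim

theorem side_deadlock {S1 S : CS R A B} {H K : R} (hs : Side S1 S H K)
    (hnm : (S1.mach H).NoMixed) {c : Config R A B} (hd : DeadlockConf S c)
    (hr : ∃ l q', (c.st H, l, q') ∈ (S1.mach H).delta ∧ l.isRecv) : DeadlockConf S1 c := by
  refine ⟨fun p hp q hq => hd.1 p (hs.sub hp) q (hs.sub hq), fun p hp => ?_⟩
  by_cases hpH : p = H
  · subst hpH
    obtain ⟨l, q', h1, h2⟩ := hr
    refine ⟨⟨l, q', h1⟩, fun l' q'' h => ?_⟩
    cases l' with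
    | rcv => trivial
    | snd => exact (hnm _ ⟨⟨_, _, h, trivial⟩, _, _, h1, h2⟩).elim
  · rw [← hs.mp p hp hpH]
    exact hd.2 p (hs.sub hp)

theorem main_aux {S1 S2 S : CS R A B} {H K : R} (hs : Side S1 S H K) (hs' : Side S2 S K H)
    (hc : (S1.mach H).Compat (S2.mach K)) {c : Config R A B} (h : Reach S c)
    (hd : DeadlockConf S c) :
    (Reach S1 c ∧ DeadlockConf S1 c) ∨ (Reach S2 c ∧ DeadlockConf S2 c) := by
  have hH := hs.sub hs.hH
  have hK := hs'.sub hs'.hH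
  obtain ⟨⟨b, hb⟩, l, q', ht⟩ := gw_receiving hs (hd.2 H hH)
  obtain ⟨⟨b', hb'⟩, -⟩ := gw_receiving hs' (hd.2 K hK)
  cases hl : l with
  | rcv s r a =>
    subst hl
    exact Or.inl ⟨proj_reach hs h ⟨b, hb⟩, side_deadlock hs hc.2.1 hd ⟨_, _, ht, trivial⟩⟩
  | snd s r a =>
    subst hl
    refine Or.inr ⟨proj_reach hs' h ⟨b', hb'⟩, side_deadlock hs' hc.2.2.1 hd ?_⟩
    obtain ⟨u, v, h1, h2, h3⟩ := sinv_reach hs hs' hc h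
    have huv : v = dualWord u := by
      rw [hd.1 H hH K hK, hd.1 K hK H hH] at h3
      rcases h3 with ⟨-, h3⟩ | ⟨-, h3⟩
      · simp [h3, dual_dual]
      · simpa using h3
    have e1 : view (c.st H) = c.st H := by rw [hb]; rfl
    have e2 : view (c.st K) = c.st K := by rw [hb']; rfl
    rw [e1] at h1
    rw [e2] at h2
    obtain ⟨p, hp⟩ := compat_path hc (path_snoc h1 ht rfl)
    rw [dual_append, ← huv] at hp
    obtain ⟨l, q1, h5, h6⟩ := path_next hc.2.2.2.2 h2 hp
    refine ⟨l, q1, h5, ?_⟩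
    cases l with
    | rcv => trivial
    | snd => simp [Act.noC, Pol.dual] at h6

end GTIR

open GTIR

/-- a reachable deadlock configuration of the composed system
restricts to a reachable deadlock configuration of `S1` or of `S2` (or both).
(Configurations are total functions, and both reachability and the deadlock
property in `Si` only constrain the components of `Si`, so the restriction is
rendered by the configuration itself.) -/
theorem stmt6_deadlock_restricts
    {R A B : Type} [Finite R] [Finite A]
    (S1 S2 : CS R A B) (H K : R)
    (hH : H ∈ S1.roles) (hK : K ∈ S2.roles)
    (hdisj : S1.roles ∩ S2.roles = ∅)
    (hcompat : (S1.mach H).Compat (S2.mach K))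
    (hwf1 : S1.WF) (hwf2 : S2.WF)
    (hfin1 : S1.FiniteSys) (hfin2 : S2.FiniteSys)
    (hhf1 : (S1.mach H).HatFree) (hhf2 : (S2.mach K).HatFree)
    (c : Config R A B) (hc : Reach (CS.compose S1 S2 H K) c)
    (hdead : DeadlockConf (CS.compose S1 S2 H K) c) :
    (Reach S1 c ∧ DeadlockConf S1 c) ∨ (Reach S2 c ∧ DeadlockConf S2 c) := by
  have dj : ∀ p, p ∈ S1.roles → p ∈ S2.roles → False := fun p h1 h2 => by
    have : p ∈ S1.roles ∩ S2.roles := ⟨h1, h2⟩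
    rw [hdisj] at this
    exact this
  have hKH : K ≠ H := fun e => dj H hH (e ▸ hK)
  refine main_aux (S := CS.compose S1 S2 H K) (H := H) (K := K) ?_ ?_ hcompat hc hdead
  · refine ⟨hH, fun h => dj K h hK, hwf1, hhf1, Set.subset_union_left, ?_, ?_⟩
    · simp [CS.compose]
    · intro p hp hpH
      have : p ≠ K := fun e => dj K (e ▸ hp) hK
      simp [CS.compose, hp, hpH, this]
  · refine ⟨hK, fun h => dj H hH h, hwf2, hhf2, Set.subset_union_right, ?_, ?_⟩
    · simp [CS.compose, hKH]
    · intro p hp hpK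
      have : p ≠ H := fun e => dj H hH (e ▸ hp)
      have h2 : p ∉ S1.roles := fun h => dj p h hp
      simp [CS.compose, h2, hpK, this]
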